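/- Promising graph, type 5: Suppose that in a play of the (K^{ℵ0}, K^4)-building game it is the first player's turn, and there are seven distinct vertices a, b, c, d, e, f, g such that the edges ab, ac, ad, ae, af, ag, bc are red, the edges bd, be, bf, ce, df are blue, and all other edges among {a, b, c, d, e, f, g} are unclaimed (in particular the vulnerable edges bg, cd, cf are unclaimed). Suppose further that on the whole board, even after adding bg, cd and cf as blue edges, the blue edges contain no K^4 and admit no blue threat. Then the first player has a winning strategy from this position: each of her moves before the last creates a red threat, and she completes a red K^4 within at most 5 further moves of hers (she begins by claiming cg, and if the second player answers bg, the induced position on {a, c, d, e, f, g} is a realised promising graph of type 4). -/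

import Mathlib

/-!
Positions in the `(K^{ℵ₀}, K^4)`-building game.  A position is a pair `(R, B)`
of disjoint finite sets of red (first player's) and blue (second player's)
edges of the complete graph on `ℕ`; an edge is unclaimed if it lies in neither
set.
-/

/-- A history of further moves played from a position, in chronological order;
the player to move plays at even indices, the other player at odd indices. -/
abbrev Hist : Type := List (Sym2 ℕ)

/-- A strategy: assigns to each sequence of previously claimed edges an edge. -/
abbrev Strategy : Type := Hist → Sym2 ℕ

/-- The edges claimed at even indices of a history. -/
def firstPlayerEdges (h : Hist) : Set (Sym2 ℕ) :=
  {x | ∃ i : Fin h.length, (i : ℕ) % 2 = 0 ∧ h.get i = x}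

/-- The edges claimed at odd indices of a history. -/
def secondPlayerEdges (h : Hist) : Set (Sym2 ℕ) :=
  {x | ∃ i : Fin h.length, (i : ℕ) % 2 = 1 ∧ h.get i = x}

/-- The red edges after the further moves `h` have been played from a position
with red edges `R`, the first player (red) moving at even indices. -/
def redAfter (R : Finset (Sym2 ℕ)) (h : Hist) : Set (Sym2 ℕ) :=
  ↑R ∪ firstPlayerEdges h

/-- The blue edges after the further moves `h` have been played from a
position with blue edges `B`, the second player (blue) moving at odd
indices. -/
def blueAfter (B : Finset (Sym2 ℕ)) (h : Hist) : Set (Sym2 ℕ) :=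
  ↑B ∪ secondPlayerEdges h

/-- An edge is a legal move if it is a proper edge (not a loop) and is
unclaimed, i.e. lies neither in the position `(R, B)` nor in the history `h`
of further moves. -/
def LegalFrom (R B : Finset (Sym2 ℕ)) (h : Hist) (x : Sym2 ℕ) : Prop :=
  ¬ x.IsDiag ∧ x ∉ R ∧ x ∉ B ∧ x ∉ h

/-- The history of further moves after `n` moves, when the player to move
follows the strategy `σ` and the other player follows the strategy `τ`. -/
def play (σ τ : Strategy) : ℕ → Hist
  | 0 => []
  | n + 1 => play σ τ n ++ [if n % 2 = 0 then σ (play σ τ n) else τ (play σ τ n)]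

/-- `E` contains all six edges on some 4-element vertex set. -/
def HasK4 (E : Set (Sym2 ℕ)) : Prop :=
  ∃ t : Finset ℕ, t.card = 4 ∧ ∀ u ∈ t, ∀ v ∈ t, u ≠ v → s(u, v) ∈ E

/-- A threat for the colour with edge set `C`, the other colour having edge
set `O`: a 4-element vertex set `t` on which the edge `x` is unclaimed while
all five other edges belong to `C`. -/
def IsThreat (C O : Set (Sym2 ℕ)) (t : Finset ℕ) (x : Sym2 ℕ) : Prop :=
  t.card = 4 ∧ (∃ u ∈ t, ∃ v ∈ t, u ≠ v ∧ x = s(u, v)) ∧ x ∉ C ∧ x ∉ O ∧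
    ∀ u ∈ t, ∀ v ∈ t, u ≠ v → s(u, v) ≠ x → s(u, v) ∈ C

/-- The colour with edge set `C` admits a threat (the other colour having edge
set `O`). -/
def HasThreat (C O : Set (Sym2 ℕ)) : Prop := ∃ t x, IsThreat C O t x

/-- From the position `(R, B)` with the first player (red) to move, the first
player has a winning strategy which completes a red `K^4` within at most
`(bound + 1) / 2` further moves of hers, each of her moves before the last
creating a red threat: against every legally playing opponent there is an odd
stage `n ≤ bound` (a stage just after one of her own moves, her `r`-th further
move being move number `2 * r - 1`) at which, all of her moves having been
legal and each of her moves before the last having created a red threat, the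
red edges contain a `K^4` while the blue edges do not. -/
def WinsFromWithinThreats (R B : Finset (Sym2 ℕ)) (bound : ℕ) : Prop :=
  ∃ σ : Strategy, ∀ τ : Strategy,
    (∀ n, n % 2 = 1 → (∃ x, LegalFrom R B (play σ τ n) x) →
      LegalFrom R B (play σ τ n) (τ (play σ τ n))) →
    ∃ n ≤ bound, n % 2 = 1 ∧
      (∀ m < n, m % 2 = 0 → LegalFrom R B (play σ τ m) (σ (play σ τ m))) ∧
      (∀ m, m % 2 = 0 → m + 1 < n →
        HasThreat (redAfter R (play σ τ (m + 1)))
          (blueAfter B (play σ τ (m + 1)))) ∧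
      HasK4 (redAfter R (play σ τ n)) ∧ ¬ HasK4 (blueAfter B (play σ τ n))

@[simp]
theorem firstPlayerEdges_nil : firstPlayerEdges [] = ∅ := by
  ext x
  simp [firstPlayerEdges]

@[simp]
theorem secondPlayerEdges_nil : secondPlayerEdges [] = ∅ := by
  ext x
  simp [secondPlayerEdges]

@[simp]
theorem firstPlayerEdges_cons (y : Sym2 ℕ) (h : Hist) :
    firstPlayerEdges (y :: h) = insert y (secondPlayerEdges h) := by
  ext x
  simp only [firstPlayerEdges, secondPlayerEdges, Set.mem_ofPred_eq, Set.mem_insert_iff,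
    List.length_cons, Fin.exists_fin_succ, Fin.val_zero, Fin.val_succ, List.get_cons_zero,
    List.get_cons_succ']
  have parity (i : ℕ) : (i + 1) % 2 = 0 ↔ i % 2 = 1 := by omega
  simp [parity, eq_comm]

@[simp]
theorem secondPlayerEdges_cons (y : Sym2 ℕ) (h : Hist) :
    secondPlayerEdges (y :: h) = firstPlayerEdges h := by
  ext x
  simp only [firstPlayerEdges, secondPlayerEdges, Set.mem_ofPred_eq,
    List.length_cons, Fin.exists_fin_succ, Fin.val_zero, Fin.val_succ, List.get_cons_zero,
    List.get_cons_succ']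
  have parity (i : ℕ) : (i + 1) % 2 = 1 ↔ i % 2 = 0 := by omega
  simp [parity]

theorem play_succ_of_even (σ τ : Strategy) {n : ℕ} {h : Hist} (hn : n % 2 = 0)
    (hp : play σ τ n = h) : play σ τ (n + 1) = h ++ [σ h] := by
  simp [play, hn, hp]

theorem play_succ_of_odd (σ τ : Strategy) {n : ℕ} {h : Hist} (hn : n % 2 = 1)
    (hp : play σ τ n = h) : play σ τ (n + 1) = h ++ [τ h] := by
  simp [play, hn, hp]

theorem HasK4.mono {E F : Set (Sym2 ℕ)} (hEF : E ⊆ F) : HasK4 E → HasK4 F := by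
  rintro ⟨t, ht, h⟩
  exact ⟨t, ht, fun u hu v hv huv => hEF (h u hu v hv huv)⟩

theorem hasK4_of_mem {E : Set (Sym2 ℕ)} {p q r t : ℕ} (hpq : p ≠ q) (hpr : p ≠ r) (hpt : p ≠ t)
    (hqr : q ≠ r) (hqt : q ≠ t) (hrt : r ≠ t) (epq : s(p, q) ∈ E) (epr : s(p, r) ∈ E)
    (ept : s(p, t) ∈ E) (eqr : s(q, r) ∈ E) (eqt : s(q, t) ∈ E) (ert : s(r, t) ∈ E) :
    HasK4 E := by
  refine ⟨{p, q, r, t}, by simp [*], ?_⟩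
  have eqp := Sym2.eq_swap ▸ epq
  have erp := Sym2.eq_swap ▸ epr
  have etp := Sym2.eq_swap ▸ ept
  have erq := Sym2.eq_swap ▸ eqr
  have etq := Sym2.eq_swap ▸ eqt
  have etr := Sym2.eq_swap ▸ ert
  simp only [Finset.mem_insert, Finset.mem_singleton]
  rintro u (rfl | rfl | rfl | rfl) v (rfl | rfl | rfl | rfl) huv <;>
    first | assumption | exact absurd rfl huv

/-- Five edges of one colour on `{p, q, r, t}` with `rt` unclaimed form a threat. -/
theorem hasThreat_of_mem {C O : Set (Sym2 ℕ)} {p q r t : ℕ} (hpq : p ≠ q) (hpr : p ≠ r)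
    (hpt : p ≠ t) (hqr : q ≠ r) (hqt : q ≠ t) (hrt : r ≠ t) (epq : s(p, q) ∈ C)
    (epr : s(p, r) ∈ C) (ept : s(p, t) ∈ C) (eqr : s(q, r) ∈ C) (eqt : s(q, t) ∈ C)
    (hC : s(r, t) ∉ C) (hO : s(r, t) ∉ O) : HasThreat C O := by
  refine ⟨{p, q, r, t}, s(r, t), by simp [*], ⟨r, by simp, t, by simp, hrt, rfl⟩, hC, hO, ?_⟩
  have eqp := Sym2.eq_swap ▸ epq
  have erp := Sym2.eq_swap ▸ epr
  have etp := Sym2.eq_swap ▸ ept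
  have erq := Sym2.eq_swap ▸ eqr
  have etq := Sym2.eq_swap ▸ eqt
  simp only [Finset.mem_insert, Finset.mem_singleton]
  rintro u (rfl | rfl | rfl | rfl) v (rfl | rfl | rfl | rfl) huv hne <;>
    first | assumption | exact absurd rfl huv | exact absurd rfl hne | exact absurd Sym2.eq_swap hne

/-- A colour without a `K^4` and without a threat cannot complete a `K^4` in one move. -/
theorem not_hasK4_insert {C O : Set (Sym2 ℕ)} (hK : ¬ HasK4 C) (hT : ¬ HasThreat C O)
    {x : Sym2 ℕ} (hx : x ∉ O) : ¬ HasK4 (insert x C) := by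
  rintro ⟨t, ht, h⟩
  have mem_of_ne : ∀ u ∈ t, ∀ v ∈ t, u ≠ v → s(u, v) ≠ x → s(u, v) ∈ C :=
    fun u hu v hv huv hne => (h u hu v hv huv).resolve_left hne
  by_cases hxC : x ∈ C
  · exact hK ⟨t, ht, fun u hu v hv huv => Set.insert_eq_of_mem hxC ▸ h u hu v hv huv⟩
  by_cases hxt : ∃ u ∈ t, ∃ v ∈ t, u ≠ v ∧ x = s(u, v)
  · exact hT ⟨t, x, ht, hxt, hxC, hx, mem_of_ne⟩
  · exact hK ⟨t, ht, fun u hu v hv huv => mem_of_ne u hu v hv huv fun he =>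
      hxt ⟨u, hu, v, hv, huv, he.symm⟩⟩

/-- The first player claims `cg`, `dg`, `fg`, `eg` in turn, completing a `K^4` as soon as the
second player fails to answer with `bg`, `cd`, `cf`, respectively; the move `eg` threatens both
`de` and `ef`. -/
def starStrategy (b c d e f g : ℕ) : Strategy
  | [_, x] => if x = s(b, g) then s(d, g) else s(b, g)
  | [_, _, _, x] => if x = s(c, d) then s(f, g) else s(c, d)
  | [_, _, _, _, _, x] => if x = s(c, f) then s(e, g) else s(c, f)
  | [_, _, _, _, _, _, _, x] => if x = s(d, e) then s(e, f) else s(d, e)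
  | _ => s(c, g)

/-- Before stage `n`, all moves of the first player are legal and create a red threat. -/
def ForcingUntil (R B : Finset (Sym2 ℕ)) (σ τ : Strategy) (n : ℕ) : Prop :=
  (∀ m < n, m % 2 = 0 → LegalFrom R B (play σ τ m) (σ (play σ τ m))) ∧
    ∀ m < n, m % 2 = 0 →
      HasThreat (redAfter R (play σ τ (m + 1))) (blueAfter B (play σ τ (m + 1)))

theorem ForcingUntil.add_two {R B : Finset (Sym2 ℕ)} {σ τ : Strategy} {n : ℕ} {h h' : Hist}
    (hf : ForcingUntil R B σ τ n) (hn : n % 2 = 0) (hp : play σ τ n = h)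
    (hp' : play σ τ (n + 1) = h') (hl : LegalFrom R B h (σ h))
    (ht : HasThreat (redAfter R h') (blueAfter B h')) : ForcingUntil R B σ τ (n + 2) := by
  subst hp hp'
  refine ⟨fun m hm hm2 => ?_, fun m hm hm2 => ?_⟩
  · obtain hlt | rfl : m < n ∨ m = n := by omega
    exacts [hf.1 m hlt hm2, hl]
  · obtain hlt | rfl : m < n ∨ m = n := by omega
    exacts [hf.2 m hlt hm2, ht]

/-- Completing a red `K^4` after forcing moves only meets the winning condition. -/
theorem ForcingUntil.win {R B : Finset (Sym2 ℕ)} {σ τ : Strategy} {n bound : ℕ} {h : Hist}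
    {y : Sym2 ℕ} (hf : ForcingUntil R B σ τ n) (hb : n + 1 ≤ bound) (hn : n % 2 = 0)
    (hp : play σ τ n = h) (hy : σ h = y) (hl : LegalFrom R B h y)
    (hred : HasK4 (redAfter R (h ++ [y]))) (hblue : ¬ HasK4 (blueAfter B (h ++ [y]))) :
    ∃ n ≤ bound, n % 2 = 1 ∧
      (∀ m < n, m % 2 = 0 → LegalFrom R B (play σ τ m) (σ (play σ τ m))) ∧
      (∀ m, m % 2 = 0 → m + 1 < n →
        HasThreat (redAfter R (play σ τ (m + 1)))
          (blueAfter B (play σ τ (m + 1)))) ∧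
      HasK4 (redAfter R (play σ τ n)) ∧ ¬ HasK4 (blueAfter B (play σ τ n)) := by
  have hp' := play_succ_of_even σ τ hn hp
  rw [hy] at hp'
  subst hp hy
  refine ⟨n + 1, hb, by omega, fun m hm hm2 => ?_, fun m hm2 hm => hf.2 m (by omega) hm2,
    by rwa [hp'], by rwa [hp']⟩
  obtain hlt | rfl : m < n ∨ m = n := by omega
  exacts [hf.1 m hlt hm2, hl]

/-- Promising graph of type 5.  Suppose that in a play of the
`(K^{ℵ₀}, K^4)`-building game it is the first player's turn and there are
seven distinct vertices `a, b, c, d, e, f, g` such that the edges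
`ab, ac, ad, ae, af, ag, bc` are red, the edges `bd, be, bf, ce, df` are blue,
and all other edges among `{a, b, c, d, e, f, g}` (namely
`bg, cd, cf, cg, de, dg, ef, eg, fg`, in particular the vulnerable edges
`bg, cd, cf`) are unclaimed.  Suppose further that on the whole board, even
after adding `bg`, `cd` and `cf` as blue edges, the blue edges contain no
`K^4` and admit no blue threat.  Then the first player has a winning strategy
from this position: each of her moves before the last creates a red threat,
and she completes a red `K^4` within at most 5 further moves of hers. -/
theorem promising_graph_type_five
    (R B : Finset (Sym2 ℕ)) (hdisj : Disjoint R B)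
    (a b c d e f g : ℕ)
    (hdist : ({a, b, c, d, e, f, g} : Finset ℕ).card = 7)
    (hab : s(a, b) ∈ R) (hac : s(a, c) ∈ R) (had : s(a, d) ∈ R)
    (hae : s(a, e) ∈ R) (haf : s(a, f) ∈ R) (hag : s(a, g) ∈ R)
    (hbc : s(b, c) ∈ R)
    (hbd : s(b, d) ∈ B) (hbe : s(b, e) ∈ B) (hbf : s(b, f) ∈ B)
    (hce : s(c, e) ∈ B) (hdf : s(d, f) ∈ B)
    (hbg : s(b, g) ∉ R ∧ s(b, g) ∉ B)
    (hcd : s(c, d) ∉ R ∧ s(c, d) ∉ B)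
    (hcf : s(c, f) ∉ R ∧ s(c, f) ∉ B)
    (hcg : s(c, g) ∉ R ∧ s(c, g) ∉ B)
    (hde : s(d, e) ∉ R ∧ s(d, e) ∉ B)
    (hdg : s(d, g) ∉ R ∧ s(d, g) ∉ B)
    (hef : s(e, f) ∉ R ∧ s(e, f) ∉ B)
    (heg : s(e, g) ∉ R ∧ s(e, g) ∉ B)
    (hfg : s(f, g) ∉ R ∧ s(f, g) ∉ B)
    (hnoblueK4 : ¬ HasK4 (↑B ∪ {s(b, g), s(c, d), s(c, f)}))
    (hnobluethreat : ¬ HasThreat (↑B ∪ {s(b, g), s(c, d), s(c, f)}) ↑R) :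
    WinsFromWithinThreats R B 9 := by
  have hcb : s(c, b) ∈ R := Sym2.eq_swap ▸ hbc
  have hnodup : ([a, b, c, d, e, f, g] : List ℕ).Nodup := by
    rw [← Multiset.coe_nodup, ← Multiset.toFinset_card_eq_card_iff_nodup]
    simpa using hdist
  have blue_safe {x : Sym2 ℕ} (hx : x ∉ R) {E : Set (Sym2 ℕ)}
      (hE : E ⊆ insert x (↑B ∪ {s(b, g), s(c, d), s(c, f)})) : ¬ HasK4 E :=
    fun h => not_hasK4_insert hnoblueK4 hnobluethreat (by simpa using hx) (h.mono hE)
  simp only [List.nodup_cons, List.mem_cons, List.not_mem_nil, not_or, not_false_eq_true,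
    List.nodup_nil, and_true, or_false] at hnodup
  obtain ⟨⟨nab, nac, nad, nae, naf, nag⟩, ⟨nbc, nbd, nbe, nbf, nbg⟩, ⟨ncd, nce, ncf, ncg⟩,
    ⟨nde, ndf, ndg⟩, ⟨nef, neg⟩, nfg⟩ := hnodup
  refine ⟨starStrategy b c d e f g, fun τ hτ => ?_⟩
  generalize hσ : starStrategy b c d e f g = σ at hτ ⊢
  have forcing0 : ForcingUntil R B σ τ 0 := ⟨by simp, by simp⟩
  have play0 : play σ τ 0 = [] := rfl
  have move0 : σ [] = s(c, g) := by simp [← hσ, starStrategy]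
  have play1 : play σ τ 1 = [s(c, g)] := by simpa [move0] using play_succ_of_even σ τ rfl play0
  have forcing2 : ForcingUntil R B σ τ 2 := by
    refine forcing0.add_two rfl play0 play1 ?_ ?_
    · simp [LegalFrom, *]
    · apply hasThreat_of_mem (p := a) (q := c) (r := b) (t := g) <;>
        simp [redAfter, blueAfter, *] <;> grind
  have legal1 : LegalFrom R B [s(c, g)]
      (τ [s(c, g)]) := by
    rw [← play1]
    refine hτ 1 rfl ⟨s(b, g), ?_⟩
    simp [LegalFrom, *]
  obtain ⟨x, hx⟩ : ∃ x, τ [s(c, g)] = x := ⟨_, rfl⟩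
  have play2 := play_succ_of_odd σ τ rfl play1
  rw [hx] at legal1 play2
  obtain ⟨-, hxR, -, hxh⟩ := legal1
  by_cases hxe : x = s(b, g)
  swap
  · have hm : σ [s(c, g), x] = s(b, g) := by simp [← hσ, starStrategy, hxe]
    refine forcing2.win (by norm_num) rfl play2 hm ?_ ?_ (blue_safe hxR ?_)
    · simp [LegalFrom, *]
      grind
    · apply hasK4_of_mem (p := a) (q := c) (r := b) (t := g) <;>
        simp [redAfter, *] <;> grind
    · intro y
      simp [blueAfter]
      grind
  subst hxe
  clear hxR hxh
  have move2 : σ [s(c, g), s(b, g)] = s(d, g) := by simp [← hσ, starStrategy]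
  have play3 : play σ τ 3 = [s(c, g), s(b, g), s(d, g)] := by
    simpa [move2] using play_succ_of_even σ τ rfl play2
  have forcing4 : ForcingUntil R B σ τ 4 := by
    refine forcing2.add_two rfl play2 play3 ?_ ?_
    · simp [LegalFrom, *]
      grind
    · apply hasThreat_of_mem (p := a) (q := g) (r := c) (t := d) <;>
        simp [redAfter, blueAfter, *] <;> grind
  have legal3 : LegalFrom R B [s(c, g), s(b, g), s(d, g)]
      (τ [s(c, g), s(b, g), s(d, g)]) := by
    rw [← play3]
    refine hτ 3 rfl ⟨s(c, d), ?_⟩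
    simp [LegalFrom, *]
  obtain ⟨x, hx⟩ : ∃ x, τ [s(c, g), s(b, g), s(d, g)] = x := ⟨_, rfl⟩
  have play4 := play_succ_of_odd σ τ rfl play3
  rw [hx] at legal3 play4
  obtain ⟨-, hxR, -, hxh⟩ := legal3
  by_cases hxe : x = s(c, d)
  swap
  · have hm : σ [s(c, g), s(b, g), s(d, g), x] = s(c, d) := by simp [← hσ, starStrategy, hxe]
    refine forcing4.win (by norm_num) rfl play4 hm ?_ ?_ (blue_safe hxR ?_)
    · simp [LegalFrom, *]
      grind
    · apply hasK4_of_mem (p := a) (q := g) (r := c) (t := d) <;>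
        simp [redAfter, *] <;> grind
    · intro y
      simp [blueAfter]
      grind
  subst hxe
  clear hxR hxh
  have move4 : σ [s(c, g), s(b, g), s(d, g), s(c, d)] = s(f, g) := by simp [← hσ, starStrategy]
  have play5 : play σ τ 5 = [s(c, g), s(b, g), s(d, g), s(c, d), s(f, g)] := by
    simpa [move4] using play_succ_of_even σ τ rfl play4
  have forcing6 : ForcingUntil R B σ τ 6 := by
    refine forcing4.add_two rfl play4 play5 ?_ ?_
    · simp [LegalFrom, *]
      grind
    · apply hasThreat_of_mem (p := a) (q := g) (r := c) (t := f) <;>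
        simp [redAfter, blueAfter, *] <;> grind
  have legal5 : LegalFrom R B [s(c, g), s(b, g), s(d, g), s(c, d), s(f, g)]
      (τ [s(c, g), s(b, g), s(d, g), s(c, d), s(f, g)]) := by
    rw [← play5]
    refine hτ 5 rfl ⟨s(c, f), ?_⟩
    simp [LegalFrom, *]
    grind
  obtain ⟨x, hx⟩ : ∃ x, τ [s(c, g), s(b, g), s(d, g), s(c, d), s(f, g)] = x := ⟨_, rfl⟩
  have play6 := play_succ_of_odd σ τ rfl play5
  rw [hx] at legal5 play6
  obtain ⟨-, hxR, -, hxh⟩ := legal5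
  by_cases hxe : x = s(c, f)
  swap
  · have hm : σ [s(c, g), s(b, g), s(d, g), s(c, d), s(f, g), x] = s(c, f) := by
      simp [← hσ, starStrategy, hxe]
    refine forcing6.win (by norm_num) rfl play6 hm ?_ ?_ (blue_safe hxR ?_)
    · simp [LegalFrom, *]
      grind
    · apply hasK4_of_mem (p := a) (q := g) (r := c) (t := f) <;>
        simp [redAfter, *] <;> grind
    · intro y
      simp [blueAfter]
      grind
  subst hxe
  clear hxR hxh
  have move6 : σ [s(c, g), s(b, g), s(d, g), s(c, d), s(f, g), s(c, f)] = s(e, g) := by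
    simp [← hσ, starStrategy]
  have play7 : play σ τ 7 = [s(c, g), s(b, g), s(d, g), s(c, d), s(f, g), s(c, f), s(e, g)] := by
    simpa [move6] using play_succ_of_even σ τ rfl play6
  have forcing8 : ForcingUntil R B σ τ 8 := by
    refine forcing6.add_two rfl play6 play7 ?_ ?_
    · simp [LegalFrom, *]
      grind
    · apply hasThreat_of_mem (p := a) (q := g) (r := d) (t := e) <;>
        simp [redAfter, blueAfter, *] <;> grind
  have legal7 : LegalFrom R B [s(c, g), s(b, g), s(d, g), s(c, d), s(f, g), s(c, f), s(e, g)]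
      (τ [s(c, g), s(b, g), s(d, g), s(c, d), s(f, g), s(c, f), s(e, g)]) := by
    rw [← play7]
    refine hτ 7 rfl ⟨s(d, e), ?_⟩
    simp [LegalFrom, *]
    grind
  obtain ⟨x, hx⟩ : ∃ x, τ [s(c, g), s(b, g), s(d, g), s(c, d), s(f, g), s(c, f), s(e, g)] = x :=
    ⟨_, rfl⟩
  have play8 := play_succ_of_odd σ τ rfl play7
  rw [hx] at legal7 play8
  obtain ⟨-, hxR, -, hxh⟩ := legal7
  by_cases hxe : x = s(d, e)
  · have hm : σ [s(c, g), s(b, g), s(d, g), s(c, d), s(f, g), s(c, f), s(e, g), x] = s(e, f) := by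
      simp [← hσ, starStrategy, hxe]
    refine forcing8.win (by norm_num) rfl play8 hm ?_ ?_ (blue_safe hxR ?_)
    · simp [LegalFrom, *]
      grind
    · apply hasK4_of_mem (p := a) (q := g) (r := e) (t := f) <;>
        simp [redAfter, *] <;> grind
    · intro y
      simp [blueAfter]
      grind
  · have hm : σ [s(c, g), s(b, g), s(d, g), s(c, d), s(f, g), s(c, f), s(e, g), x] = s(d, e) := by
      simp [← hσ, starStrategy, hxe]
    refine forcing8.win (by norm_num) rfl play8 hm ?_ ?_ (blue_safe hxR ?_)
    · simp [LegalFrom, *]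
      grind
    · apply hasK4_of_mem (p := a) (q := g) (r := d) (t := e) <;>
        simp [redAfter, *] <;> grind
    · intro y
      simp [blueAfter]
      grind
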